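/- Let K be a convex body in R^n such that D_n (the Euclidean unit ball) is its maximal volume inscribed ellipsoid (John position). Then M_2*(K) ≤ T_2(X_K*), where M_2*(K) = (∫_{S^{n-1}} (‖θ‖_K*)² dσ(θ))^{1/2} and ‖·‖_K* is the support function (dual norm). -/

import Mathlib

open MeasureTheory ProbabilityTheory
open scoped RealInnerProductSpace

noncomputable section

/-- The Haar probability measure on the unit sphere of `EuclideanSpace ℝ (Fin n)`. -/
def sphereProb (n : ℕ) : Measure (Metric.sphere (0 : EuclideanSpace ℝ (Fin n)) 1) :=
  ((volume : Measure (EuclideanSpace ℝ (Fin n))).toSphere Set.univ)⁻¹ •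
    (volume : Measure (EuclideanSpace ℝ (Fin n))).toSphere

/-- The polar body `K° = {y | ⟨x,y⟩ ≤ 1 ∀ x ∈ K}`. -/
def polarBody {n : ℕ} (K : Set (EuclideanSpace ℝ (Fin n))) : Set (EuclideanSpace ℝ (Fin n)) :=
  {y | ∀ x ∈ K, ⟪x, y⟫ ≤ 1}

section PolarCoordinates

variable {E : Type*} [NormedAddCommGroup E] [NormedSpace ℝ E] [MeasurableSpace E] [BorelSpace E]
  [FiniteDimensional ℝ E] [Nontrivial E]

/-- Integration in polar coordinates of a positively homogeneous function times a radial one. -/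
theorem integral_homogeneous_mul_fun_norm (μ : Measure E) [μ.IsAddHaarMeasure] {f : E → ℝ} {k : ℕ}
    (hf : ∀ r : ℝ, 0 < r → ∀ x, f (r • x) = r ^ k * f x) (g : ℝ → ℝ) :
    ∫ x, f x * g ‖x‖ ∂μ = (∫ θ : Metric.sphere (0 : E) 1, f θ ∂μ.toSphere) *
      ∫ r in Set.Ioi (0 : ℝ), r ^ (Module.finrank ℝ E - 1) * (r ^ k * g r) := by
  calc
    ∫ x, f x * g ‖x‖ ∂μ = ∫ x : ({(0)}ᶜ : Set E), f x * g ‖x.1‖ ∂(μ.comap (↑)) := by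
      rw [integral_subtype_comap (measurableSet_singleton _).compl fun x ↦ f x * g ‖x‖,
        MeasureTheory.restrict_compl_singleton]
    _ = ∫ p, f p.1 * ((p.2 : ℝ) ^ k * g p.2)
          ∂μ.toSphere.prod (.volumeIoiPow (Module.finrank ℝ E - 1)) := by
      rw [← μ.measurePreserving_homeomorphUnitSphereProd.integral_comp
        (Homeomorph.measurableEmbedding _)]
      congr with x
      have hx : 0 < ‖(x : E)‖ := norm_pos_iff.2 x.2
      have := hf ‖(x : E)‖ hx (‖(x : E)‖⁻¹ • (x : E))
      rw [smul_inv_smul₀ hx.ne'] at this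
      simp only [homeomorphUnitSphereProd_apply_snd_coe, homeomorphUnitSphereProd_apply_fst_coe]
      rw [this]
      ring
    _ = (∫ θ : Metric.sphere (0 : E) 1, f θ ∂μ.toSphere) *
          ∫ r : Set.Ioi (0 : ℝ), (r : ℝ) ^ k * g r ∂.volumeIoiPow (Module.finrank ℝ E - 1) :=
      integral_prod_mul (fun θ : Metric.sphere (0 : E) 1 ↦ f θ)
        fun r : Set.Ioi (0 : ℝ) ↦ (r : ℝ) ^ k * g r
    _ = _ := by
      congr 1
      simp only [Measure.volumeIoiPow, ENNReal.ofReal]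
      rw [integral_withDensity_eq_integral_smul,
        integral_subtype_comap measurableSet_Ioi fun a : ℝ ↦
          Real.toNNReal (a ^ (Module.finrank ℝ E - 1)) • (a ^ k * g a),
        setIntegral_congr_fun measurableSet_Ioi fun x hx ↦ ?_]
      · rw [NNReal.smul_def, Real.coe_toNNReal _ (pow_nonneg hx.out.le _), smul_eq_mul]
      · exact (measurable_subtype_coe.pow_const _).real_toNNReal

end PolarCoordinates

theorem integral_pow_mul_sq_mul_exp_neg_half_sq {n : ℕ} (hn : n ≠ 0) :
    ∫ r in Set.Ioi (0 : ℝ), r ^ (n - 1) * (r ^ 2 * Real.exp (-(1 / 2) * r ^ 2)) =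
      n * ∫ r in Set.Ioi (0 : ℝ), r ^ (n - 1) * Real.exp (-(1 / 2) * r ^ 2) := by
  have hn0 : (0 : ℝ) < n := by positivity
  have h₁ := integral_rpow_mul_exp_neg_mul_rpow (p := 2) (q := (n : ℝ) - 1) (b := 1 / 2)
    (by norm_num) (by linarith) (by norm_num)
  have h₂ := integral_rpow_mul_exp_neg_mul_rpow (p := 2) (q := (n : ℝ) + 1) (b := 1 / 2)
    (by norm_num) (by linarith) (by norm_num)
  have hcast : ((n - 1 : ℕ) : ℝ) = (n : ℝ) - 1 := by
    rw [Nat.cast_sub (Nat.one_le_iff_ne_zero.2 hn), Nat.cast_one]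
  have e₁ : ∫ r in Set.Ioi (0 : ℝ), r ^ (n - 1) * Real.exp (-(1 / 2) * r ^ 2) =
      ∫ r in Set.Ioi (0 : ℝ), r ^ ((n : ℝ) - 1) * Real.exp (-(1 / 2) * r ^ (2 : ℝ)) := by
    refine setIntegral_congr_fun measurableSet_Ioi fun r _ ↦ ?_
    simp only [Real.rpow_two, ← hcast, Real.rpow_natCast]
  have e₂ : ∫ r in Set.Ioi (0 : ℝ), r ^ (n - 1) * (r ^ 2 * Real.exp (-(1 / 2) * r ^ 2)) =
      ∫ r in Set.Ioi (0 : ℝ), r ^ ((n : ℝ) + 1) * Real.exp (-(1 / 2) * r ^ (2 : ℝ)) := by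
    refine setIntegral_congr_fun measurableSet_Ioi fun r _ ↦ ?_
    have : (n : ℝ) + 1 = ((n - 1 + 2 : ℕ) : ℝ) := by push_cast [hcast]; ring
    simp only [Real.rpow_two, this, Real.rpow_natCast, pow_add, mul_assoc]
  rw [e₁, e₂, h₁, h₂, show ((n : ℝ) + 1 + 1) / 2 = n / 2 + 1 by ring,
    show ((n : ℝ) - 1 + 1) / 2 = n / 2 by ring, Real.Gamma_add_one (by positivity),
    show -((n : ℝ) + 1 + 1) / 2 = -((n : ℝ) - 1 + 1) / 2 + -1 by ring,
    Real.rpow_add (by norm_num), Real.rpow_neg_one]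
  ring

section Gaussian

variable {E : Type*} [NormedAddCommGroup E] [InnerProductSpace ℝ E] [FiniteDimensional ℝ E]
  [MeasurableSpace E] [BorelSpace E]

/-- The standard Gaussian measure has density proportional to `exp (-‖x‖² / 2)`. -/
theorem stdGaussian_eq_withDensity :
    stdGaussian E = (volume : Measure E).withDensity fun x ↦ ENNReal.ofReal
      ((∫ y : E, Real.exp (-(1 / 2) * ‖y‖ ^ 2))⁻¹ * Real.exp (-(1 / 2) * ‖x‖ ^ 2)) := by
  set Z : ℝ := ∫ y : E, Real.exp (-(1 / 2) * ‖y‖ ^ 2) with hZ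
  have hZpos : 0 < Z := by
    rw [hZ, GaussianFourier.integral_rexp_neg_mul_sq_norm (by norm_num)]
    positivity
  have hZint : Integrable fun y : E ↦ Real.exp (-(1 / 2) * ‖y‖ ^ 2) :=
    .of_integral_ne_zero hZpos.ne'
  have hfin : IsFiniteMeasure ((volume : Measure E).withDensity fun x ↦ ENNReal.ofReal
      (Z⁻¹ * Real.exp (-(1 / 2) * ‖x‖ ^ 2))) :=
    isFiniteMeasure_withDensity_ofReal (hZint.const_mul _).2
  refine Measure.ext_of_charFun ?_
  ext t
  have hZc : (Z : ℂ) = ∫ v : E, Complex.exp (-(1 / 2 : ℂ) * ‖v‖ ^ 2) := by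
    rw [hZ, ← integral_complex_ofReal]
    congr with y
    push_cast
    rfl
  have h₀ := GaussianFourier.integral_cexp_neg_mul_sq_norm (V := E) (b := 1 / 2) (by norm_num)
  have h₁ := GaussianFourier.integral_cexp_neg_mul_sq_norm_add (V := E) (b := 1 / 2)
    (by norm_num) Complex.I t
  rw [← h₀, ← hZc] at h₁
  rw [charFun_stdGaussian, charFun_apply, integral_withDensity_eq_integral_toReal_smul
    (by fun_prop) (by simp)]
  have : ∀ x : E, (ENNReal.ofReal (Z⁻¹ * Real.exp (-(1 / 2) * ‖x‖ ^ 2))).toReal •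
      Complex.exp (⟪x, t⟫ * Complex.I) =
      (Z : ℂ)⁻¹ * Complex.exp (-(1 / 2 : ℂ) * ‖x‖ ^ 2 + Complex.I * ⟪t, x⟫) := by
    intro x
    rw [ENNReal.toReal_ofReal (by positivity), Complex.real_smul, Complex.exp_add,
      real_inner_comm, mul_comm Complex.I]
    push_cast
    ring
  simp_rw [this]
  rw [integral_const_mul, h₁, inv_mul_cancel_left₀ (by exact_mod_cast hZpos.ne'), Complex.I_sq]
  congr 1
  ring

/-- The Gaussian second moment of a `2`-homogeneous function is `dim E` times its
average over the unit sphere. -/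
theorem integral_stdGaussian_of_homogeneous [Nontrivial E] {f : E → ℝ}
    (hf : ∀ r : ℝ, 0 < r → ∀ x, f (r • x) = r ^ 2 * f x) :
    ∫ x, f x ∂stdGaussian E = Module.finrank ℝ E *
      (((volume : Measure E).toSphere.real Set.univ)⁻¹ *
        ∫ θ : Metric.sphere (0 : E) 1, f θ ∂(volume : Measure E).toSphere) := by
  have h₂ := integral_homogeneous_mul_fun_norm (volume : Measure E) hf
    fun r ↦ Real.exp (-(1 / 2) * r ^ 2)
  have h₀ := integral_homogeneous_mul_fun_norm (volume : Measure E) (f := fun _ ↦ 1) (k := 0)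
    (by simp) fun r ↦ Real.exp (-(1 / 2) * r ^ 2)
  rw [integral_pow_mul_sq_mul_exp_neg_half_sq Module.finrank_pos.ne'] at h₂
  simp only [one_mul, pow_zero, integral_const, smul_eq_mul, mul_one] at h₀
  have hpos : (∫ y : E, Real.exp (-(1 / 2) * ‖y‖ ^ 2)) ≠ 0 := by
    rw [GaussianFourier.integral_rexp_neg_mul_sq_norm (by norm_num)]
    positivity
  have hdens : ∀ x : E, (ENNReal.ofReal ((∫ y : E, Real.exp (-(1 / 2) * ‖y‖ ^ 2))⁻¹ *
      Real.exp (-(1 / 2) * ‖x‖ ^ 2))).toReal • f x =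
      (∫ y : E, Real.exp (-(1 / 2) * ‖y‖ ^ 2))⁻¹ *
        (f x * Real.exp (-(1 / 2) * ‖x‖ ^ 2)) := by
    intro x
    rw [ENNReal.toReal_ofReal (by positivity), smul_eq_mul]
    ring
  rw [stdGaussian_eq_withDensity, integral_withDensity_eq_integral_toReal_smul
    (by fun_prop) (by simp)]
  simp_rw [hdens]
  rw [integral_const_mul, h₂]
  rw [h₀] at hpos ⊢
  have := left_ne_zero_of_mul hpos
  have := right_ne_zero_of_mul hpos
  generalize ∫ r in Set.Ioi (0 : ℝ),
    r ^ (Module.finrank ℝ E - 1) * Real.exp (-(1 / 2) * r ^ 2) = c at *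
  field_simp

/-- A Gaussian combination of vectors forming a decomposition of the identity is standard
Gaussian. -/
theorem map_sum_smul_pi_gaussianReal {ι : Type*} [Fintype ι] {x : ι → E}
    (hx : ∀ t : E, ∑ i, ⟪x i, t⟫ ^ 2 = ‖t‖ ^ 2) :
    (Measure.pi fun _ : ι ↦ gaussianReal 0 1).map (fun g ↦ ∑ i, g i • x i) = stdGaussian E := by
  have : IsFiniteMeasure
      ((Measure.pi fun _ : ι ↦ gaussianReal 0 1).map (fun g ↦ ∑ i, g i • x i)) :=
    inferInstance
  refine Measure.ext_of_charFun ?_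
  ext t
  rw [charFun_stdGaussian, charFun_apply, integral_map
    (Measurable.aemeasurable (by fun_prop)) (Measurable.aestronglyMeasurable (by fun_prop))]
  simp_rw [sum_inner, real_inner_smul_left, Complex.ofReal_sum, Finset.sum_mul, Complex.exp_sum]
  rw [integral_fintype_prod_eq_prod (𝕜 := ℂ)
    (f := fun i (y : ℝ) ↦ Complex.exp ((y * ⟪x i, t⟫ : ℝ) * Complex.I))]
  have (i : ι) : ∫ y : ℝ, Complex.exp ((y * ⟪x i, t⟫ : ℝ) * Complex.I) ∂gaussianReal 0 1 =
      Complex.exp (-(⟪x i, t⟫ : ℂ) ^ 2 / 2) := by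
    have h := charFun_gaussianReal (μ := 0) (v := 1) ⟪x i, t⟫
    rw [charFun_apply_real] at h
    convert h using 1
    · congr with y
      push_cast
      ring_nf
    · simp [neg_div]
  simp_rw [this]
  rw [← Complex.exp_sum, ← Finset.sum_div, Finset.sum_neg_distrib]
  congr 3
  exact_mod_cast hx t

end Gaussian

/-- The weights of a decomposition of the identity by unit vectors sum to the dimension. -/
theorem sum_weights_eq_finrank {E : Type*} [NormedAddCommGroup E] [InnerProductSpace ℝ E]
    [FiniteDimensional ℝ E] {ι : Type*} [Fintype ι] {v : ι → E} {l : ι → ℝ}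
    (hv : ∀ i, ‖v i‖ = 1) (hiso : ∀ θ : E, ∑ i, l i * ⟪v i, θ⟫ ^ 2 = ‖θ‖ ^ 2) :
    ∑ i, l i = Module.finrank ℝ E := by
  let b := stdOrthonormalBasis ℝ E
  calc
    ∑ i, l i = ∑ i, ∑ j, l i * ⟪v i, b j⟫ ^ 2 := by
      simp_rw [← Finset.mul_sum, b.sum_sq_inner_left, hv, one_pow, mul_one]
    _ = Module.finrank ℝ E := by
      rw [Finset.sum_comm]
      simp [hiso]

section PolarBody

variable {n : ℕ} {K : Set (EuclideanSpace ℝ (Fin n))}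

theorem convex_polarBody (K : Set (EuclideanSpace ℝ (Fin n))) : Convex ℝ (polarBody K) := by
  intro y hy z hz a b ha hb hab x hx
  rw [inner_add_right, real_inner_smul_right, real_inner_smul_right]
  nlinarith [hy x hx, hz x hx]

theorem polarBody_mem_nhds_zero (hK : Bornology.IsBounded K) : polarBody K ∈ nhds 0 := by
  obtain ⟨R, hR, hKR⟩ := hK.exists_pos_norm_le
  refine Filter.mem_of_superset (Metric.ball_mem_nhds 0 (inv_pos.2 hR)) fun y hy x hx ↦ ?_
  rw [mem_ball_zero_iff] at hy
  calc
    ⟪x, y⟫ ≤ ‖x‖ * ‖y‖ := real_inner_le_norm x y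
    _ ≤ R * R⁻¹ := by gcongr; exact hKR x hx
    _ = 1 := mul_inv_cancel₀ hR.ne'

end PolarBody

/-- If `K` is a convex body in John position (the Euclidean unit ball is its maximal volume
inscribed ellipsoid, with John decomposition given by contact points `vᵢ` and weights `λᵢ`),
then `M₂*(K) ≤ T₂(X_K*)`, where `T₂` is a Gaussian type-2 constant of the dual norm. -/
theorem M2_star_le_type2_of_john {n : ℕ} {m : ℕ}
    (K : Set (EuclideanSpace ℝ (Fin n))) (hKconv : Convex ℝ K) (hKcompact : IsCompact K)
    (hKsymm : K = -K) (hball : Metric.closedBall (0 : EuclideanSpace ℝ (Fin n)) 1 ⊆ K)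
    (v : Fin m → EuclideanSpace ℝ (Fin n)) (l : Fin m → ℝ) (hl : ∀ i, 0 < l i)
    (hvK : ∀ i, v i ∈ K) (hvnorm : ∀ i, ‖v i‖ = 1)
    (hvcontact : ∀ i, ∀ x ∈ K, ⟪x, v i⟫ ≤ 1)
    (hiso : ∀ θ : EuclideanSpace ℝ (Fin n), ∑ i, l i * ⟪v i, θ⟫ ^ 2 = ‖θ‖ ^ 2)
    (T₂ : ℝ) (hT₂ : 0 ≤ T₂)
    (htype : ∀ (N : ℕ) (x : Fin N → EuclideanSpace ℝ (Fin n)),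
      ∫ g : Fin N → ℝ, gauge (polarBody K) (∑ i, g i • x i) ^ 2
          ∂(Measure.pi fun _ : Fin N => gaussianReal 0 1) ≤
        T₂ ^ 2 * ∑ i, gauge (polarBody K) (x i) ^ 2) :
    Real.sqrt (∫ θ : Metric.sphere (0 : EuclideanSpace ℝ (Fin n)) 1,
        gauge (polarBody K) (θ : EuclideanSpace ℝ (Fin n)) ^ 2 ∂(sphereProb n)) ≤ T₂ := by
  rcases Nat.eq_zero_or_pos n with rfl | hn
  · have : IsEmpty (Metric.sphere (0 : EuclideanSpace ℝ (Fin 0)) 1) :=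
      ⟨fun θ ↦ by simpa [Subsingleton.elim (θ : EuclideanSpace ℝ (Fin 0)) 0] using θ.2⟩
    simpa [integral_of_isEmpty] using hT₂
  have : Nonempty (Fin n) := ⟨⟨0, hn⟩⟩
  have hn0 : (0 : ℝ) < n := by exact_mod_cast hn
  have hcont : Continuous (gauge (polarBody K)) :=
    continuous_gauge (convex_polarBody K) (polarBody_mem_nhds_zero hKcompact.isBounded)
  have hhom (r : ℝ) (hr : 0 < r) (x : EuclideanSpace ℝ (Fin n)) :
      gauge (polarBody K) (r • x) ^ 2 = r ^ 2 * gauge (polarBody K) x ^ 2 := by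
    rw [gauge_smul_of_nonneg hr.le, smul_eq_mul, mul_pow]
  have hsphere := integral_stdGaussian_of_homogeneous
    (f := fun x ↦ gauge (polarBody K) x ^ 2) hhom
  have hmap := map_sum_smul_pi_gaussianReal (x := fun i ↦ √(l i) • v i) fun t ↦ by
    simpa [real_inner_smul_left, mul_pow, Real.sq_sqrt (hl _).le] using hiso t
  have hbound := htype m fun i ↦ √(l i) • v i
  have hgauge : ∑ i, gauge (polarBody K) (√(l i) • v i) ^ 2 ≤ n := calc
    _ ≤ ∑ i, l i := by
      refine Finset.sum_le_sum fun i _ ↦ ?_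
      rw [hhom _ (Real.sqrt_pos.2 (hl i)), Real.sq_sqrt (hl i).le]
      exact mul_le_of_le_one_right (hl i).le
        (pow_le_one₀ (gauge_nonneg _) (gauge_le_one_of_mem (hvcontact i)))
    _ = n := by simpa using sum_weights_eq_finrank hvnorm hiso
  rw [← integral_map (f := fun x ↦ gauge (polarBody K) x ^ 2)
    (Measurable.aemeasurable (by fun_prop)) (by fun_prop), hmap, hsphere,
    finrank_euclideanSpace_fin] at hbound
  rw [Real.sqrt_le_left hT₂, sphereProb, integral_smul_measure, ENNReal.toReal_inv, smul_eq_mul]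
  refine le_of_mul_le_mul_left (hbound.trans ?_) hn0
  rw [mul_comm (n : ℝ)]
  gcongr
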